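/- arXiv:math/0605269 — 2 statements merged into one kernel-verified Lean document; each statement's English description precedes it below -/
import Mathlib

section
/- Let V be a nonzero finite-dimensional complex inner product space, let A be a self-adjoint endomorphism of V, and let r, k ≥ 1 be integers. Let Ã denote the endomorphism of the r-fold direct sum W = (Fin r → V) (with the product inner product) acting componentwise by A. Let B be a self-adjoint endomorphism of W whose kernel has complex dimension at least r(k−1)+1, and let c ≥ 0 be a real number such that ‖(Ã − B) w‖ ≤ c ‖w‖ for all w ∈ W. Then N(A², c²) ≥ k, i.e. A² has at least k eigenvalues (counted with multiplicity) that are at most c². -/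
/-- `countLE T c` is the number of eigenvalues of `T` that are `≤ c`, counted
with multiplicity: the dimension of the span of the eigenspaces of `T` for
(real) eigenvalues `μ ≤ c`. -/
noncomputable def countLE {V : Type*} [AddCommGroup V] [Module ℂ V]
    (T : Module.End ℂ V) (c : ℝ) : ℕ :=
  Module.finrank ℂ ↥(⨆ μ : ℝ, ⨆ _ : μ ≤ c, Module.End.eigenspace T (μ : ℂ))

/-- A nonzero vector orthogonal to the eigenspaces of `A²` for eigenvalues `≤ c²` is stretched by
`A` by a factor of more than `c`. -/
theorem LinearMap.IsSymmetric.sq_mul_norm_sq_lt_norm_sq_apply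
    {V : Type*} [NormedAddCommGroup V] [InnerProductSpace ℂ V] [FiniteDimensional ℂ V]
    {A : V →ₗ[ℂ] V} (hA : A.IsSymmetric) {c : ℝ} {v : V}
    (hv : v ∈ (⨆ μ : ℝ, ⨆ _ : μ ≤ c ^ 2,
      Module.End.eigenspace (A ∘ₗ A : Module.End ℂ V) (μ : ℂ))ᗮ) (hv0 : v ≠ 0) :
    c ^ 2 * ‖v‖ ^ 2 < ‖A v‖ ^ 2 := by
  let b := hA.eigenvectorBasis rfl
  have hrepr (i) : b.repr (A v) i = hA.eigenvalues rfl i * b.repr v i :=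
    hA.eigenvectorBasis_apply_self_apply rfl v i
  have hsmall (i) (hi : hA.eigenvalues rfl i ^ 2 ≤ c ^ 2) : b.repr v i = 0 := by
    rw [b.repr_apply_apply]
    refine (Submodule.mem_orthogonal _ v).1 hv _ ?_
    refine Submodule.mem_iSup_of_mem (hA.eigenvalues rfl i ^ 2)
      (Submodule.mem_iSup_of_mem hi (Module.End.mem_eigenspace_iff.2 ?_))
    simp [b, hA.apply_eigenvectorBasis, smul_smul, pow_two, -Complex.ofReal_mul]
  have hlt (i) (hi : b.repr v i ≠ 0) :
      c ^ 2 * ‖b.repr v i‖ ^ 2 < ‖b.repr (A v) i‖ ^ 2 := by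
    rw [hrepr, norm_mul, mul_pow]
    simp only [Complex.norm_real, Real.norm_eq_abs, sq_abs]
    have hpos : 0 < ‖b.repr v i‖ ^ 2 := by positivity
    exact mul_lt_mul_of_pos_right (lt_of_not_ge fun h => hi (hsmall i h)) hpos
  have hle (i) : c ^ 2 * ‖b.repr v i‖ ^ 2 ≤ ‖b.repr (A v) i‖ ^ 2 := by
    by_cases hi : b.repr v i = 0
    · simp [hrepr, hi]
    · exact (hlt i hi).le
  obtain ⟨j, hj⟩ : ∃ j, b.repr v j ≠ 0 := by
    by_contra! h
    exact hv0 (b.repr.map_eq_zero_iff.1 (PiLp.ext h))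
  rw [← b.repr.norm_map v, ← b.repr.norm_map (A v), EuclideanSpace.norm_sq_eq,
    EuclideanSpace.norm_sq_eq, Finset.mul_sum]
  exact Finset.sum_lt_sum (fun i _ => hle i) ⟨j, Finset.mem_univ j, hlt j hj⟩

/-- A subspace of `Vʳ` of dimension greater than `r · dim S` contains a nonzero vector all of whose
components are orthogonal to `S`. -/
theorem PiLp.exists_mem_ne_zero_forall_mem_orthogonal
    {ι V : Type*} [Fintype ι] [NormedAddCommGroup V] [InnerProductSpace ℂ V]
    [FiniteDimensional ℂ V] (S : Submodule ℂ V) (K : Submodule ℂ (PiLp 2 fun _ : ι => V))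
    (h : Fintype.card ι * Module.finrank ℂ S < Module.finrank ℂ K) :
    ∃ w ∈ K, w ≠ 0 ∧ ∀ i, w i ∈ Sᗮ := by
  let f : K →ₗ[ℂ] (ι → S) := LinearMap.pi fun i =>
    (S.orthogonalProjectionOnto : V →ₗ[ℂ] S) ∘ₗ
      (PiLp.proj 2 (fun _ : ι => V) i : (PiLp 2 fun _ : ι => V) →L[ℂ] V).toLinearMap ∘ₗ K.subtype
  have hf : LinearMap.ker f ≠ ⊥ := LinearMap.ker_ne_bot_of_finrank_lt (by
    simpa [Module.finrank_pi_fintype] using h)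
  obtain ⟨w, hw, hw0⟩ := Submodule.exists_mem_ne_zero_of_ne_bot hf
  refine ⟨w, w.2, by simpa using hw0, fun i => ?_⟩
  exact Submodule.orthogonalProjectionOnto_eq_zero_iff.1 (congrFun (LinearMap.mem_ker.1 hw) i)

/-- **Quantitative Vafa–Witten principle.**
Let `A` be a self-adjoint endomorphism of a nonzero finite-dimensional complex
inner product space `V`, let `r, k ≥ 1`, let `Ã` act componentwise by `A` on
the `r`-fold direct sum `W = (Fin r → V)`, and let `B` be a self-adjoint
endomorphism of `W` whose kernel has dimension at least `r(k-1)+1` with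
`‖(Ã - B) w‖ ≤ c ‖w‖` for all `w` (where `c ≥ 0`).  Then `A²` has at least `k`
eigenvalues (with multiplicity) that are `≤ c²`. -/
theorem vafaWitten_quantitative
    {V : Type*} [NormedAddCommGroup V] [InnerProductSpace ℂ V]
    [FiniteDimensional ℂ V] [Nontrivial V]
    (A : V →ₗ[ℂ] V) (hA : A.IsSymmetric)
    (r k : ℕ) (hr : 1 ≤ r) (hk : 1 ≤ k)
    (Atilde B : (PiLp 2 fun _ : Fin r => V) →ₗ[ℂ] (PiLp 2 fun _ : Fin r => V))
    (hAt : ∀ (w : PiLp 2 fun _ : Fin r => V) (i : Fin r), Atilde w i = A (w i))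
    (hB : B.IsSymmetric)
    (hker : r * (k - 1) + 1 ≤ Module.finrank ℂ (LinearMap.ker B))
    (c : ℝ) (hc : 0 ≤ c)
    (hnorm : ∀ w : PiLp 2 fun _ : Fin r => V, ‖(Atilde - B) w‖ ≤ c * ‖w‖) :
    k ≤ countLE (A ∘ₗ A) (c ^ 2) := by
  by_contra! hlt
  obtain ⟨w, hwB, hw0, hw⟩ := PiLp.exists_mem_ne_zero_forall_mem_orthogonal
    (⨆ μ : ℝ, ⨆ _ : μ ≤ c ^ 2, Module.End.eigenspace (A ∘ₗ A : Module.End ℂ V) (μ : ℂ))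
    (LinearMap.ker B) (by
      rw [Fintype.card_fin]
      exact (Nat.mul_le_mul_left r (Nat.le_sub_one_of_lt hlt)).trans_lt hker)
  have hnw : ‖Atilde w‖ ≤ c * ‖w‖ := by
    simpa [LinearMap.mem_ker.1 hwB] using hnorm w
  have hsq : ‖Atilde w‖ ^ 2 ≤ c ^ 2 * ‖w‖ ^ 2 := by
    rw [← mul_pow]
    gcongr
  obtain ⟨j, hj⟩ : ∃ j, w j ≠ 0 := by
    by_contra! h
    exact hw0 (PiLp.ext h)
  rw [PiLp.norm_sq_eq_of_L2, PiLp.norm_sq_eq_of_L2, Finset.mul_sum] at hsq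
  refine hsq.not_gt (Finset.sum_lt_sum (fun i _ => ?_) ⟨j, Finset.mem_univ j, ?_⟩)
  · rw [hAt]
    by_cases hi : w i = 0
    · simp [hi]
    · exact (hA.sq_mul_norm_sq_lt_norm_sq_apply (hw i) hi).le
  · rw [hAt]
    exact hA.sq_mul_norm_sq_lt_norm_sq_apply (hw j) hj
end

section
/- Let 𝔤 be a real Lie algebra equipped with a norm ‖·‖, let e₁, …, e_n ∈ 𝔤 be such that for every index i there exists an index j with [eᵢ, eⱼ] ≠ 0, and let μ₁, …, μ_n be real numbers with 0 < μᵢ ≤ 1. If ∑_{i,j} μᵢ² μⱼ² ‖[eᵢ, eⱼ]‖² = ∑_{i,j} ‖[eᵢ, eⱼ]‖², then μᵢ = 1 for all i. (This is the rigidity step of Section 3: equality in the Vafa–Witten estimate forces all scaling factors μᵢ to equal 1, hence the two metrics coincide; the hypothesis that every eᵢ has a nonvanishing bracket with some eⱼ reflects that a Lie algebra of compact type has trivial center.) -/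
/-- **Rigidity step (Section 3 of the paper).**
Let `𝔤` be a real normed space with a Lie bracket `br` (bilinear,
antisymmetric, Jacobi), let `e₁, …, e_n ∈ 𝔤` be such that every `eᵢ` has a
nonvanishing bracket with some `eⱼ`, and let `0 < μᵢ ≤ 1`.  If
`∑_{i,j} μᵢ²μⱼ² ‖[eᵢ,eⱼ]‖² = ∑_{i,j} ‖[eᵢ,eⱼ]‖²` then all `μᵢ = 1`. -/
theorem vafaWitten_rigidity
    {𝔤 : Type*} [NormedAddCommGroup 𝔤] [NormedSpace ℝ 𝔤]
    (br : 𝔤 →ₗ[ℝ] 𝔤 →ₗ[ℝ] 𝔤)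
    (hanti : ∀ x y : 𝔤, br x y = - br y x)
    (hjacobi : ∀ x y z : 𝔤, br x (br y z) + br y (br z x) + br z (br x y) = 0)
    {n : ℕ} (e : Fin n → 𝔤)
    (hne : ∀ i, ∃ j, br (e i) (e j) ≠ 0)
    (μ : Fin n → ℝ) (hμ : ∀ i, 0 < μ i ∧ μ i ≤ 1)
    (heq : ∑ i, ∑ j, μ i ^ 2 * μ j ^ 2 * ‖br (e i) (e j)‖ ^ 2
         = ∑ i, ∑ j, ‖br (e i) (e j)‖ ^ 2) :
    ∀ i, μ i = 1 := by
  have hsq : ∀ i, μ i ^ 2 ≤ 1 := fun i ↦ pow_le_one₀ (hμ i).1.le (hμ i).2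
  have hle : ∀ i j, μ i ^ 2 * μ j ^ 2 * ‖br (e i) (e j)‖ ^ 2 ≤ ‖br (e i) (e j)‖ ^ 2 :=
    fun i j ↦ mul_le_of_le_one_left (sq_nonneg _)
      (mul_le_one₀ (hsq i) (sq_nonneg _) (hsq j))
  intro i
  obtain ⟨j, hj⟩ := hne i
  have hrow := (Finset.sum_eq_sum_iff_of_le
    fun i _ ↦ Finset.sum_le_sum fun j _ ↦ hle i j).1 heq i (Finset.mem_univ i)
  have hterm := (Finset.sum_eq_sum_iff_of_le fun j _ ↦ hle i j).1 hrow j (Finset.mem_univ j)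
  have hprod : μ i ^ 2 * μ j ^ 2 = 1 :=
    (mul_eq_right₀ (pow_ne_zero 2 (norm_ne_zero_iff.2 hj))).1 hterm
  have hone : 1 ≤ μ i ^ 2 :=
    hprod ▸ mul_le_of_le_one_right (sq_nonneg (μ i)) (hsq j)
  exact (hμ i).2.antisymm ((one_le_sq_iff₀ (hμ i).1.le).1 hone)
end
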